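/- In a 3-regular graph, the number of Hamiltonian cycles containing any given edge is even. -/

import Mathlib

open Finset in
lemma even_card_of_invol {α : Type*} [DecidableEq α] (s : Finset α) (g : α → α)
    (h1 : ∀ a ∈ s, g a ∈ s) (h2 : ∀ a ∈ s, g a ≠ a) (h3 : ∀ a ∈ s, g (g a) = a) :
    Even s.card := by
  have : ∑ a ∈ s, (1 : ZMod 2) = 0 :=
    Finset.sum_involution (fun a _ => g a) (fun _ _ => by decide) (fun a ha _ => h2 a ha)
      (fun a ha => h1 a ha) (fun a ha => h3 a ha)
  rw [Finset.sum_const, nsmul_one] at this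
  exact (ZMod.natCast_eq_zero_iff_even).1 this

/-- reversal of the tail after position k -/
def rho {m : ℕ} (k : Fin (m+4)) (i : Fin (m+4)) : Fin (m+4) :=
  if h : i ≤ k then i else ⟨m + 4 + k.val - i.val, by
    have := i.2; have := k.2; rw [Fin.le_def] at h; omega⟩

lemma rho_val {m : ℕ} (k i : Fin (m+4)) :
    (rho k i).val = if i.val ≤ k.val then i.val else m + 4 + k.val - i.val := by
  unfold rho
  by_cases h : i ≤ k
  · rw [dif_pos h, if_pos (Fin.le_def.1 h)]
  · rw [dif_neg h, if_neg (fun h' => h (Fin.le_def.2 h'))]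

lemma rho_rho {m : ℕ} (k i : Fin (m+4)) : rho k (rho k i) = i := by
  apply Fin.ext
  have := i.2
  rw [rho_val, rho_val]
  split_ifs <;> omega

/-- Hamiltonian paths starting with x y -/
def HP {V : Type*} (G : SimpleGraph V) {m : ℕ} (x y : V) (f : Fin (m+4) → V) : Prop :=
  f.Injective ∧ f 0 = x ∧ f 1 = y ∧ ∀ i j : Fin (m+4), j.val = i.val + 1 → G.Adj (f i) (f j)

lemma HP_rho {V : Type*} {G : SimpleGraph V} {m : ℕ} {x y : V} {f : Fin (m+4) → V}
    (hf : HP G x y f) (k : Fin (m+4)) (hk : 1 ≤ k.val) (hk2 : k.val + 2 < m + 4)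
    (hadj : G.Adj (f k) (f (Fin.last _))) : HP G x y (f ∘ rho k) := by
  obtain ⟨h1, h2, h3, h4⟩ := hf
  refine ⟨h1.comp (Function.LeftInverse.injective (rho_rho k)), ?_, ?_, ?_⟩
  · have : rho k 0 = 0 := by apply Fin.ext; rw [rho_val]; simp
    simp [this, h2]
  · have : rho k 1 = 1 := by apply Fin.ext; rw [rho_val, if_pos (by simpa using hk)]
    simp [this, h3]
  · intro i j hij
    have hi := i.2
    have hj := j.2
    have ri := rho_val k i
    have rj := rho_val k j
    simp only [Function.comp]
    rcases lt_trichotomy i.val k.val with h | h | h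
    · apply h4; rw [ri, rj, if_pos (by omega), if_pos (by omega)]; exact hij
    · have e1 : rho k i = k := by apply Fin.ext; rw [ri, if_pos (by omega)]; exact h
      have e2 : rho k j = Fin.last _ := by
        apply Fin.ext; rw [rj, if_neg (by omega)]; simp; omega
      rw [e1, e2]; exact hadj
    · refine SimpleGraph.Adj.symm ?_; apply h4; rw [ri, rj, if_neg (by omega), if_neg (by omega)]; omega

open Classical in
lemma even_closed {V : Type*} [Fintype V] (G : SimpleGraph V)
    [DecidableRel G.Adj] (hreg : ∀ v, G.degree v = 3) {m : ℕ} (hm : Fintype.card V = m + 4)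
    (x y : V) :
    Even (Finset.univ.filter (fun f : Fin (m+4) → V =>
      HP G x y f ∧ G.Adj (f 0) (f (Fin.last _)))).card := by
  set P := Finset.univ.filter (fun f : Fin (m+4) → V => HP G x y f) with hP
  let good (f : Fin (m+4) → V) (k : Fin (m+4)) : Prop :=
    1 ≤ k.val ∧ k.val + 2 < m + 4 ∧ G.Adj (f k) (f (Fin.last _))
  let Q := P.sigma (fun f => Finset.univ.filter (good f))
  have hQ : Even Q.card := by
    apply even_card_of_invol Q (fun a => ⟨a.1 ∘ rho a.2, a.2⟩)
    · rintro ⟨f, k⟩ h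
      simp only [Q, P, Finset.mem_sigma, Finset.mem_filter, Finset.mem_univ, true_and, good] at h ⊢
      obtain ⟨hf, h1, h2, h3⟩ := h
      refine ⟨HP_rho hf k h1 h2 h3, h1, h2, ?_⟩
      have e1 : rho k k = k := by apply Fin.ext; rw [rho_val]; simp
      have e2 : (rho k (Fin.last _)).val = k.val + 1 := by
        rw [rho_val, if_neg (by simp; omega)]; simp; omega
      simp only [Function.comp, e1]
      exact hf.2.2.2 _ _ e2
    · rintro ⟨f, k⟩ h heq
      simp only [Q, P, Finset.mem_sigma, Finset.mem_filter, Finset.mem_univ, true_and, good] at h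
      obtain ⟨hf, h1, h2, h3⟩ := h
      simp only [Sigma.mk.injEq, heq_eq_eq, and_true] at heq
      have := congrFun heq (Fin.last _)
      have := congrArg Fin.val (hf.1 this)
      rw [rho_val, if_neg (by simp; omega)] at this
      simp at this; omega
    · rintro ⟨f, k⟩ h
      simp only [Sigma.mk.injEq, heq_eq_eq, and_true]
      funext i
      simp [rho_rho]
  have key : ∀ f ∈ P, (Finset.univ.filter (good f)).card +
      (if G.Adj (f 0) (f (Fin.last _)) then 1 else 0) = 2 := by
    intro f hf
    simp only [P, Finset.mem_filter, Finset.mem_univ, true_and] at hf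
    have hbij : f.Bijective := by
      rw [Fintype.bijective_iff_injective_and_card]; exact ⟨hf.1, by simp [hm]⟩
    have h3 : (Finset.univ.filter (fun k => G.Adj (f k) (f (Fin.last _)))).card = 3 := by
      refine Eq.trans ?_ (hreg (f (Fin.last _)))
      rw [← SimpleGraph.card_neighborFinset_eq_degree]
      apply Finset.card_bij (fun k _ => f k)
      · intro k hk; simpa [SimpleGraph.adj_comm] using hk
      · intro a _ b _ h; exact hf.1 h
      · intro b hb
        obtain ⟨a, rfl⟩ := hbij.2 b
        exact ⟨a, by simpa [SimpleGraph.adj_comm] using hb, rfl⟩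
    let q : Fin (m+4) := ⟨m+2, by omega⟩
    have hq : G.Adj (f q) (f (Fin.last _)) := hf.2.2.2 _ _ (by simp [q])
    have h0 : (Finset.univ.filter (fun k => G.Adj (f k) (f (Fin.last _)))) =
      insert q (Finset.univ.filter (good f) ∪
        (if G.Adj (f 0) (f (Fin.last _)) then {0} else ∅)) := by
      ext k
      simp only [Finset.mem_filter, Finset.mem_univ, true_and, Finset.mem_insert, Finset.mem_union,
        good]
      constructor
      · intro h
        by_cases hk0 : k = 0
        · subst hk0; simp [h]
        by_cases hkq : k = q
        · simp [hkq]
        have hkl : k ≠ Fin.last _ := by rintro rfl; exact G.loopless.irrefl _ h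
        right; left
        have := k.2
        simp only [ne_eq, Fin.ext_iff, q, Fin.val_last, Fin.val_zero] at hk0 hkq hkl
        exact ⟨by omega, by omega, h⟩
      · rintro (rfl | h | h)
        · exact hq
        · exact h.2.2
        · split_ifs at h with h'
          · simp at h; subst h; exact h'
          · simp at h
    rw [h0, Finset.card_insert_of_notMem, Finset.card_union_of_disjoint] at h3
    · split_ifs at h3 ⊢ <;> simp at h3 ⊢ <;> omega
    · split_ifs
      · simp [good]
      · simp
    · simp only [Finset.mem_union, Finset.mem_filter, good, q]
      split_ifs <;> simp
  have hsum : Q.card + (P.filter (fun f => G.Adj (f 0) (f (Fin.last _)))).card = 2 * P.card := by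
    rw [Finset.card_sigma, Finset.card_filter, ← Finset.sum_add_distrib, Finset.sum_congr rfl key]
    simp [mul_comm]
  rw [← Finset.filter_filter, ← hP]
  have : Even (2 * P.card) := even_two_mul _
  rw [← hsum, Nat.even_add] at this
  exact this.1 hQ

/-- cyclic Hamiltonian ordering -/
def HC {V : Type*} (G : SimpleGraph V) {m : ℕ} (f : Fin (m+4) → V) : Prop :=
  f.Injective ∧ ∀ i, G.Adj (f i) (f (i+1))

lemma HP_iff {V : Type*} (G : SimpleGraph V) {m : ℕ} (x y : V) (f : Fin (m+4) → V) :
    (HP G x y f ∧ G.Adj (f 0) (f (Fin.last _))) ↔ (HC G f ∧ f 0 = x ∧ f 1 = y) := by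
  constructor
  · rintro ⟨⟨h1, h2, h3, h4⟩, h5⟩
    refine ⟨⟨h1, fun i => ?_⟩, h2, h3⟩
    by_cases hi : i = Fin.last _
    · subst hi; rw [Fin.last_add_one]; exact h5.symm
    · apply h4
      rw [Fin.val_add_one, if_neg hi]
  · rintro ⟨⟨h1, h4⟩, h2, h3⟩
    refine ⟨⟨h1, h2, h3, fun i j hij => ?_⟩, ?_⟩
    · have : j = i + 1 := by
        apply Fin.ext
        rw [Fin.val_add_one, if_neg, hij]
        rintro rfl
        have := j.2
        simp at hij; omega
      rw [this]; exact h4 i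
    · have := h4 (Fin.last _)
      rw [Fin.last_add_one] at this; exact this.symm

/-- edge set -/
def ES {V : Type*} [DecidableEq V] {m : ℕ} (f : Fin (m+4) → V) : Finset (Sym2 V) :=
  Finset.univ.image (fun i => s(f i, f (i+1)))

lemma fin_two_ne {m : ℕ} (j : Fin (m+4)) : j + 1 + 1 ≠ j := by
  intro h
  rw [add_assoc] at h
  have h := add_eq_left.1 h
  have := congrArg Fin.val h
  simp [Fin.val_add] at this
  rw [Nat.mod_eq_of_lt (by omega)] at this
  omega

section
open scoped Fin.NatCast Fin.CommRing

lemma ES_inj {V : Type*} [DecidableEq V] {m : ℕ} {f g : Fin (m+4) → V}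
    (hf : f.Injective) (hg : g.Injective) (h0 : f 0 = g 0) (h1 : f 1 = g 1)
    (h : ES f = ES g) : f = g := by
  have key : ∀ k : ℕ, f (k : Fin (m+4)) = g (k : Fin (m+4)) ∧
      f ((k : Fin (m+4)) + 1) = g ((k : Fin (m+4)) + 1) := by
    intro k
    induction k with
    | zero => simpa using ⟨h0, h1⟩
    | succ k ih =>
      obtain ⟨i0, i1⟩ := ih
      push_cast
      refine ⟨i1, ?_⟩
      set i : Fin (m+4) := (k : Fin (m+4))
      have hm : s(f (i+1), f (i+1+1)) ∈ ES g := by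
        rw [← h]; exact Finset.mem_image_of_mem _ (Finset.mem_univ _)
      simp only [ES, Finset.mem_image, Finset.mem_univ, true_and] at hm
      obtain ⟨j, hj⟩ := hm
      rw [Sym2.eq_iff] at hj
      rcases hj with ⟨ha, hb⟩ | ⟨ha, hb⟩
      · rw [i1] at ha
        rw [hg ha] at hb; exact hb.symm
      · rw [i1] at hb
        have : j = i := add_right_cancel (hg hb)
        rw [this, ← i0] at ha
        exact absurd (hf ha).symm (fin_two_ne i)
  funext i
  have := (key i.val).1
  simpa using this

lemma exists_walk {V : Type*} (G : SimpleGraph V) (N : ℕ) : ∀ (g : ℕ → V)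
    (_ : ∀ i, G.Adj (g i) (g (i+1))),
    ∃ p : G.Walk (g 0) (g N), p.length = N ∧ ∀ i ≤ N, p.getVert i = g i := by
  induction N with
  | zero => intro g _; exact ⟨.nil, rfl, fun i hi => by simp at hi; simp [hi]⟩
  | succ N ih =>
    intro g hg
    obtain ⟨p, hp, hp2⟩ := ih (fun i => g (i+1)) (fun i => hg (i+1))
    refine ⟨.cons (hg 0) p, by simp [hp], fun i hi => ?_⟩
    cases i with
    | zero => simp
    | succ i => rw [SimpleGraph.Walk.getVert_cons_succ]; exact hp2 i (by omega)

lemma edges_eq {V : Type*} [DecidableEq V] {G : SimpleGraph V} {m : ℕ} {f : Fin (m+4) → V}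
    {u v : V} (p : G.Walk u v) (hl : p.length = m + 4)
    (hp : ∀ i ≤ m + 4, p.getVert i = f (i : Fin (m+4))) : p.edges.toFinset = ES f := by
  ext e
  induction e with | h a b
  simp only [List.mem_toFinset, SimpleGraph.Walk.mk_mem_edges_iff_exists, ES, Finset.mem_image,
    Finset.mem_univ, true_and, hl]
  constructor
  · rintro ⟨i, hi, h⟩
    refine ⟨(i : Fin (m+4)), ?_⟩
    rw [hp i (by omega), hp (i+1) (by omega)] at h
    push_cast at h; exact h
  · rintro ⟨i, h⟩
    refine ⟨i.val, i.2, ?_⟩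
    have := i.2
    rw [hp _ (by omega), hp _ (by omega)]
    push_cast
    simpa using h

lemma natCast_inj_lt {m a b : ℕ} (ha : a < m + 4) (hb : b < m + 4)
    (h : (a : Fin (m+4)) = (b : Fin (m+4))) : a = b := by
  have := congrArg Fin.val h
  rwa [Fin.val_natCast, Fin.val_natCast, Nat.mod_eq_of_lt ha, Nat.mod_eq_of_lt hb] at this

lemma natCast_top (m : ℕ) : ((m + 4 : ℕ) : Fin (m+4)) = 0 := by
  apply Fin.ext; simp [Fin.val_natCast]

lemma HC_walk {V : Type*} [Fintype V] [DecidableEq V] {G : SimpleGraph V} {m : ℕ}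
    (hm : Fintype.card V = m + 4) {f : Fin (m+4) → V} (hf : HC G f) :
    ∃ (u : V) (p : G.Walk u u), p.IsHamiltonianCycle ∧ p.edges.toFinset = ES f := by
  obtain ⟨hinj, hadj⟩ := hf
  let g : ℕ → V := fun i => f (i : Fin (m+4))
  have hg : ∀ i, G.Adj (g i) (g (i+1)) := fun i => by
    simp only [g]; push_cast; exact hadj _
  obtain ⟨q, hq, hq2⟩ := exists_walk G (m+3) (fun i => g (i+1)) (fun i => hg (i+1))
  have htop : g (m+3+1) = g 0 := by
    simp only [g]; rw [natCast_top]; simp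
  let p : G.Walk (g 0) (g (m+3+1)) := .cons (hg 0) q
  have hpl : p.length = m + 4 := by simp [p, hq]
  have hpv : ∀ i ≤ m + 4, p.getVert i = f (i : Fin (m+4)) := by
    intro i hi
    cases i with
    | zero => simp [p, g]
    | succ i => simp only [p]; rw [SimpleGraph.Walk.getVert_cons_succ]; exact hq2 i (by omega)
  have hgi : ∀ i ≤ m + 3, ∀ j ≤ m + 3, g (i+1) = g (j+1) → i = j := by
    intro i hi j hj h
    have h := hinj h
    push_cast at h
    exact natCast_inj_lt (by omega) (by omega) (add_right_cancel h)
  have hpath : q.IsPath := by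
    rw [← SimpleGraph.Walk.IsPath.getVert_injOn_iff]
    intro i hi j hj h
    simp only [Set.mem_ofPred_eq, hq] at hi hj
    rw [hq2 i hi, hq2 j hj] at h
    exact hgi i hi j hj h
  have hne : s(g 0, g 1) ∉ q.edges := by
    rw [SimpleGraph.Walk.mk_mem_edges_iff_exists]
    rintro ⟨i, hi, h⟩
    rw [hq] at hi
    rw [hq2 i (by omega), hq2 (i+1) (by omega), Sym2.eq_iff, ← htop] at h
    rcases h with ⟨h, h'⟩ | ⟨h, h'⟩
    · have := hgi i (by omega) (m+3) (by omega) h; omega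
    · have := hgi i (by omega) 0 (by omega) h
      have := hgi (i+1) (by omega) (m+3) (by omega) h'; omega
  have hgen : ∀ (w : V) (hw : w = g 0) (q : G.Walk (g 1) w), q.IsPath → q.length = m + 3 →
      s(g 0, g 1) ∉ q.edges → ∃ p : G.Walk (g 0) (g 0), p.IsHamiltonianCycle ∧
        p.edges = s(g 0, g 1) :: q.edges := by
    rintro w rfl q h1 h2 h3
    refine ⟨.cons (hg 0) q, ?_, by simp⟩
    rw [SimpleGraph.Walk.isHamiltonianCycle_iff_isCycle_and_length_eq]
    exact ⟨(SimpleGraph.Walk.cons_isCycle_iff _ _).2 ⟨h1, h3⟩, by simp [h2, hm]⟩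
  obtain ⟨p', h1, h2⟩ := hgen _ htop q hpath hq hne
  refine ⟨_, p', h1, ?_⟩
  rw [h2, ← edges_eq p hpl hpv]
  simp [p]

lemma walk_HC {V : Type*} [Fintype V] [DecidableEq V] {G : SimpleGraph V} {m : ℕ}
    (hm : Fintype.card V = m + 4) {u : V} (p : G.Walk u u) (hp : p.IsHamiltonianCycle) :
    ∃ f : Fin (m+4) → V, HC G f ∧ p.edges.toFinset = ES f := by
  have hl : p.length = m + 4 := by rw [hp.length_eq, hm]
  let f : Fin (m+4) → V := fun i => p.getVert i.val
  have hv : ∀ i ≤ m + 4, p.getVert i = f (i : Fin (m+4)) := by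
    intro i hi
    rcases hi.lt_or_eq with h | h
    · simp only [f]; rw [Fin.val_natCast, Nat.mod_eq_of_lt h]
    · subst h; rw [natCast_top]; simp only [f, Fin.val_zero]; rw [← hl]; simp
  refine ⟨f, ⟨?_, ?_⟩, edges_eq p hl hv⟩
  · intro i j h
    have := i.2
    have := j.2
    exact Fin.ext (hp.isCycle.getVert_injOn' (by simp; omega) (by simp; omega) h)
  · intro i
    have hi := i.2
    have := p.adj_getVert_succ (i := i.val) (by omega)
    rw [hv _ (by omega), hv _ (by omega)] at this
    push_cast at this
    simpa using this

end

lemma HC_norm {V : Type*} [DecidableEq V] {G : SimpleGraph V} {m : ℕ}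
    {f : Fin (m+4) → V} (hf : HC G f) {x y : V} (h : s(x, y) ∈ ES f) :
    ∃ g : Fin (m+4) → V, (HC G g ∧ g 0 = x ∧ g 1 = y) ∧ ES g = ES f := by
  simp only [ES, Finset.mem_image, Finset.mem_univ, true_and] at h
  obtain ⟨i, hi⟩ := h
  rw [Sym2.eq_iff] at hi
  rcases hi with ⟨h1, h2⟩ | ⟨h1, h2⟩
  · refine ⟨fun j => f (i + j), ⟨⟨fun a b h => add_left_cancel (hf.1 h), fun j => ?_⟩, ?_, ?_⟩, ?_⟩
    · have := hf.2 (i + j)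
      rw [add_assoc] at this; exact this
    · simpa using h1
    · exact h2
    · ext e
      simp only [ES, Finset.mem_image, Finset.mem_univ, true_and]
      constructor
      · rintro ⟨j, rfl⟩; exact ⟨i + j, by rw [add_assoc]⟩
      · rintro ⟨j, rfl⟩; exact ⟨j - i, by rw [← add_assoc, add_sub_cancel]⟩
  · refine ⟨fun j => f (i + 1 - j), ⟨⟨fun a b h => sub_right_injective (hf.1 h), fun j => ?_⟩, ?_, ?_⟩, ?_⟩
    · have := hf.2 (i + 1 - (j + 1))
      rw [show i + 1 - (j + 1) + 1 = i + 1 - j by abel] at this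
      exact this.symm
    · simpa using h2
    · simpa using h1
    · ext e
      simp only [ES, Finset.mem_image, Finset.mem_univ, true_and]
      constructor
      · rintro ⟨j, rfl⟩
        exact ⟨i + 1 - (j + 1), by
          rw [show i + 1 - (j + 1) + 1 = i + 1 - j by abel, Sym2.eq_swap]⟩
      · rintro ⟨j, rfl⟩
        exact ⟨i - j, by
          rw [show i + 1 - (i - j) = j + 1 by abel, show i + 1 - (i - j + 1) = j by abel,
            Sym2.eq_swap]⟩


/-- Smith's Theorem, Tutte 1946: In a 3-regular graph, the number
of Hamiltonian cycles containing any given edge is even.  (Hamiltonian cycles are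
counted as subgraphs, i.e. by their edge sets.) -/
theorem stmt_18 {V : Type*} [Fintype V] [DecidableEq V] (G : SimpleGraph V)
    [DecidableRel G.Adj] (hreg : ∀ v, G.degree v = 3)
    (e : Sym2 V) (he : e ∈ G.edgeSet) :
    Even {s : Finset (Sym2 V) | e ∈ s ∧ ∃ (u : V) (p : G.Walk u u),
      p.IsHamiltonianCycle ∧ p.edges.toFinset = s}.ncard := by
  classical
  induction e with | h x y
  obtain ⟨m, hm⟩ : ∃ m, Fintype.card V = m + 4 := by
    have := G.degree_lt_card_verts x
    rw [hreg] at this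
    exact ⟨Fintype.card V - 4, by omega⟩
  have h := even_closed G hreg hm x y
  convert h using 1
  rw [← Set.ncard_coe_finset]
  symm
  apply Set.ncard_congr (fun f _ => ES f)
  · intro f hf
    simp only [Finset.coe_filter, Finset.mem_univ, true_and, Set.mem_ofPred_eq, HP_iff] at hf
    obtain ⟨hc, h0, h1⟩ := hf
    refine ⟨?_, HC_walk hm hc⟩
    simp only [ES, Finset.mem_image, Finset.mem_univ, true_and]
    exact ⟨0, by rw [zero_add, h0, h1]⟩
  · intro f g hf hg h
    simp only [Finset.coe_filter, Finset.mem_univ, true_and, Set.mem_ofPred_eq, HP_iff] at hf hg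
    exact ES_inj hf.1.1 hg.1.1 (hf.2.1.trans hg.2.1.symm) (hf.2.2.trans hg.2.2.symm) h
  · rintro s ⟨hs, u, p, hp, rfl⟩
    obtain ⟨f, hf, he⟩ := walk_HC hm p hp
    rw [he] at hs ⊢
    obtain ⟨g, hg, hge⟩ := HC_norm hf hs
    refine ⟨g, ?_, hge⟩
    simp only [Finset.coe_filter, Finset.mem_univ, true_and, Set.mem_ofPred_eq, HP_iff]
    exact hg
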